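/- Let G and H be weighted directed graphs on disjoint vertex sets, let u ∈ V(G) and v ∈ V(H), and suppose v has total incoming weight d in H. Let K be the weighted directed graph obtained from the disjoint union of G and H by adding a single directed edge from u to v with weight w > 0. Then for every x ∈ V(G), ept_rzf(K, x) ≤ (d + w)/w + ept_rzf(G, x) + ept_rzf(H, v). Moreover the bound is sharp: for all m, n > 0 and all d, w > 0 there exist such G, H, u, v, x with ept_rzf(G,x) = m, ept_rzf(H,v) = n, and ept_rzf(K, x) = (d + w)/w + m + n. -/

import Mathlib

open scoped ENNReal NNReal

namespace RZF

variable {V : Type*} [Fintype V] [DecidableEq V]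

/-- Probability that the white vertex `x` turns blue in one round of weighted
randomized zero forcing with weights `w`, given the current blue set `B`
(`0` when the total incoming weight of `x` is `0`). -/
noncomputable def turnProb (w : V → V → ℝ≥0) (B : Finset V) (x : V) : ℝ≥0 :=
  (∑ u ∈ B, w u x) / ∑ u, w u x

/-- One-round transition probability of the RZF Markov chain from blue set `B`
to blue set `C`: each white vertex independently turns blue with probability
`turnProb w B ·`, and blue vertices stay blue. -/
noncomputable def stepProb (w : V → V → ℝ≥0) (B C : Finset V) : ℝ≥0∞ :=
  if B ⊆ C then
    (∏ x ∈ C \ B, (turnProb w B x : ℝ≥0∞)) *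
      ∏ x ∈ Cᶜ, (1 - (turnProb w B x : ℝ≥0∞))
  else 0

/-- Distribution of the blue set after `t` rounds, started from `S`. -/
noncomputable def state (w : V → V → ℝ≥0) (S : Finset V) : ℕ → Finset V → ℝ≥0∞
  | 0 => fun C => if C = S then 1 else 0
  | t + 1 => fun C => ∑ B : Finset V, state w S t B * stepProb w B C

/-- Expected propagation time `∑ₜ P(Bₜ ≠ V(G))`; this equals `E[τ]` when the
all-blue state is reachable from `S`, and `∞` otherwise. -/
noncomputable def ept (w : V → V → ℝ≥0) (S : Finset V) : ℝ≥0∞ :=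
  ∑' t : ℕ, ∑ C ∈ Finset.univ.filter (fun C : Finset V => C ≠ Finset.univ),
    state w S t C

/-- Minimum expected propagation time over singleton starting sets. -/
noncomputable def eptMin (w : V → V → ℝ≥0) : ℝ≥0∞ :=
  ⨅ v : V, ept w {v}

/-- The weight function of an unweighted directed graph: weight `1` on each
edge and `0` otherwise, so that `turnProb` is the fraction of in-neighbors
that are blue. -/
def unweight (adj : V → V → Prop) [DecidableRel adj] : V → V → ℝ≥0 :=
  fun u v => if adj u v then 1 else 0

end RZF

/-- `reachIn adj t a b` : there is a directed path of length at most `t`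
from `a` to `b` in the directed graph with adjacency relation `adj`. -/
def reachIn {V : Type*} (adj : V → V → Prop) : ℕ → V → V → Prop
  | 0, a, b => a = b
  | t + 1, a, b => reachIn adj t a b ∨ ∃ c, reachIn adj t a c ∧ adj c b

/-- The weight function of the graph `K` obtained from the disjoint union of
weighted directed graphs `G` (weights `wG`) and `H` (weights `wH`) by adding a
single directed edge from `u ∈ V(G)` to `v ∈ V(H)` of weight `ω`. -/
noncomputable def joinWeight {V₁ V₂ : Type*} [DecidableEq V₁] [DecidableEq V₂]
    (wG : V₁ → V₁ → ℝ≥0) (wH : V₂ → V₂ → ℝ≥0) (u : V₁) (v : V₂) (ω : ℝ≥0) :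
    (V₁ ⊕ V₂) → (V₁ ⊕ V₂) → ℝ≥0
  | Sum.inl a, Sum.inl b => wG a b
  | Sum.inr a, Sum.inr b => wH a b
  | Sum.inl a, Sum.inr b => if a = u ∧ b = v then ω else 0
  | Sum.inr _, Sum.inl _ => 0

namespace RZF

/-- Transition kernel in which each element `x ∉ B` is added independently with
probability `q x`. -/
noncomputable def addKernel {V : Type*} [Fintype V] [DecidableEq V] (q : V → ℝ≥0∞)
    (B C : Finset V) : ℝ≥0∞ :=
  ∏ x, if x ∈ B then (if x ∈ C then 1 else 0) else if x ∈ C then q x else 1 - q x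

section Kernel

variable {V : Type*} [Fintype V] [DecidableEq V]

theorem addKernel_eq_zero {q : V → ℝ≥0∞} {B C : Finset V} (h : ¬ B ⊆ C) :
    addKernel q B C = 0 := by
  obtain ⟨x, hB, hC⟩ := Finset.not_subset.1 h
  exact Finset.prod_eq_zero (Finset.mem_univ x) (by simp [hB, hC])

theorem addKernel_congr {q r : V → ℝ≥0∞} {B : Finset V} (h : ∀ x ∉ B, q x = r x)
    (C : Finset V) : addKernel q B C = addKernel r B C := by
  refine Finset.prod_congr rfl fun x _ => ?_
  by_cases hx : x ∈ B
  · simp [hx]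
  · simp [hx, h x hx]

theorem stepProb_eq_addKernel (w : V → V → ℝ≥0) (B C : Finset V) :
    stepProb w B C = addKernel (fun x => (turnProb w B x : ℝ≥0∞)) B C := by
  by_cases h : B ⊆ C
  · rw [stepProb, if_pos h, addKernel, ← Finset.prod_mul_prod_compl C]
    congr 1
    · rw [← Finset.prod_sdiff h]
      rw [Finset.prod_congr (g := fun _ => (1 : ℝ≥0∞)) (s₁ := B) rfl
        fun x hx => by simp [hx, h hx]]
      rw [Finset.prod_const_one, mul_one]
      refine Finset.prod_congr rfl fun x hx => ?_
      rw [Finset.mem_sdiff] at hx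
      simp [hx.1, hx.2]
    · refine Finset.prod_congr rfl fun x hx => ?_
      rw [Finset.mem_compl] at hx
      have hB : x ∉ B := fun hB => hx (h hB)
      simp [hx, hB]
  · rw [stepProb, if_neg h, addKernel_eq_zero h]

theorem sum_addKernel {q : V → ℝ≥0∞} (hq : ∀ x, q x ≤ 1) (B : Finset V) :
    ∑ C, addKernel q B C = 1 := by
  have key := Finset.prod_add (fun x => if x ∈ B then (1 : ℝ≥0∞) else q x)
    (fun x => if x ∈ B then (0 : ℝ≥0∞) else 1 - q x) Finset.univ
  rw [Finset.powerset_univ] at key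
  calc ∑ C, addKernel q B C
      = ∑ C : Finset V, (∏ x ∈ C, if x ∈ B then (1 : ℝ≥0∞) else q x) *
          ∏ x ∈ Finset.univ \ C, if x ∈ B then (0 : ℝ≥0∞) else 1 - q x := by
        refine Finset.sum_congr rfl fun C _ => ?_
        rw [addKernel, ← Finset.prod_mul_prod_compl C, Finset.compl_eq_univ_sdiff]
        congr 1
        · exact Finset.prod_congr rfl fun x hx => by simp [hx]
        · refine Finset.prod_congr rfl fun x hx => ?_
          simp [(Finset.mem_sdiff.1 hx).2]
    _ = 1 := by
        rw [← key]
        refine Finset.prod_eq_one fun x _ => ?_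
        by_cases hx : x ∈ B
        · simp [hx]
        · simp [hx, add_tsub_cancel_of_le (hq x)]

theorem addKernel_self_of_single {q : V → ℝ≥0∞} {B : Finset V} {y : V} (hy : y ∉ B)
    (hq : ∀ x ∉ B, x ≠ y → q x = 0) : addKernel q B B = 1 - q y := by
  rw [addKernel, Finset.prod_eq_single y]
  · simp [hy]
  · intro x _ hx
    by_cases hB : x ∈ B <;> simp [hB]
    rw [hq x hB hx, tsub_zero]
  · simp

theorem addKernel_insert_of_single {q : V → ℝ≥0∞} {B : Finset V} {y : V} (hy : y ∉ B)
    (hq : ∀ x ∉ B, x ≠ y → q x = 0) : addKernel q B (insert y B) = q y := by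
  rw [addKernel, Finset.prod_eq_single y]
  · simp [hy]
  · intro x _ hx
    by_cases hB : x ∈ B <;> simp [hB, hx]
    rw [hq x hB hx, tsub_zero]
  · simp

theorem sum_addKernel_mul_of_single {q : V → ℝ≥0∞} {B : Finset V} {y : V} (hy : y ∉ B)
    (hq : ∀ x ∉ B, x ≠ y → q x = 0) (f : Finset V → ℝ≥0∞) :
    ∑ C, addKernel q B C * f C = q y * f (insert y B) + (1 - q y) * f B := by
  have hne : insert y B ≠ B := fun h => hy (h ▸ Finset.mem_insert_self y B)
  rw [← addKernel_self_of_single hy hq, ← addKernel_insert_of_single hy hq,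
    ← Finset.sum_pair (f := fun C => addKernel q B C * f C) hne]
  symm
  refine Finset.sum_subset (Finset.subset_univ _) fun C _ hC => ?_
  by_cases hBC : B ⊆ C
  · obtain ⟨x, hxC, hx⟩ : ∃ x ∈ C, x ∉ insert y B := by
      by_contra! hcon
      have hle : C ⊆ insert y B := hcon
      refine hC ?_
      rw [Finset.mem_insert, Finset.mem_singleton]
      by_cases hyC : y ∈ C
      · exact Or.inl (hle.antisymm (Finset.insert_subset hyC hBC))
      · exact Or.inr (((Finset.subset_insert_iff_of_notMem hyC).1 hle).antisymm hBC)
    rw [Finset.mem_insert, not_or] at hx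
    have : addKernel q B C = 0 :=
      Finset.prod_eq_zero (Finset.mem_univ x) (by simp [hx.2, hxC, hq x hx.2 hx.1])
    rw [this, zero_mul]
  · rw [addKernel_eq_zero hBC, zero_mul]

end Kernel

theorem turnProb_le_one {V : Type*} [Fintype V] (w : V → V → ℝ≥0) (B : Finset V) (x : V) :
    turnProb w B x ≤ 1 :=
  div_le_one_of_le₀ (Finset.sum_le_sum_of_subset (Finset.subset_univ B)) zero_le

section FirstStep

variable {V : Type*} [Fintype V] [DecidableEq V]

theorem sum_stepProb (w : V → V → ℝ≥0) (B : Finset V) : ∑ C, stepProb w B C = 1 := by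
  simp_rw [stepProb_eq_addKernel]
  exact sum_addKernel (fun x => by exact_mod_cast turnProb_le_one w B x) B

theorem state_succ' (w : V → V → ℝ≥0) (t : ℕ) (S C : Finset V) :
    state w S (t + 1) C = ∑ B, stepProb w S B * state w B t C := by
  induction t generalizing C with
  | zero => simp [state]
  | succ t ih =>
    rw [state]
    simp_rw [ih, state, Finset.sum_mul, Finset.mul_sum]
    rw [Finset.sum_comm]
    simp_rw [mul_assoc]

/-- Probability that some vertex is still white after `t` rounds. -/
noncomputable def tail (w : V → V → ℝ≥0) (S : Finset V) (t : ℕ) : ℝ≥0∞ :=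
  ∑ C ∈ Finset.univ.filter (fun C : Finset V => C ≠ Finset.univ), state w S t C

theorem tail_zero (w : V → V → ℝ≥0) (S : Finset V) :
    tail w S 0 = if S = Finset.univ then 0 else 1 := by
  simp [tail, state, Finset.sum_ite_eq']

theorem tail_succ (w : V → V → ℝ≥0) (S : Finset V) (t : ℕ) :
    tail w S (t + 1) = ∑ B, stepProb w S B * tail w B t := by
  simp_rw [tail, state_succ', Finset.mul_sum]
  exact Finset.sum_comm

theorem ept_eq_tsum_tail (w : V → V → ℝ≥0) (S : Finset V) :
    ept w S = ∑' t, tail w S t := rfl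

/-- First-step equation for the expected propagation time. -/
theorem ept_eq (w : V → V → ℝ≥0) (S : Finset V) :
    ept w S = (if S = Finset.univ then 0 else 1) + ∑ C, stepProb w S C * ept w C := by
  rw [ept_eq_tsum_tail, tsum_eq_zero_add' ENNReal.summable, tail_zero]
  simp_rw [tail_succ, ept_eq_tsum_tail, ← ENNReal.tsum_mul_left]
  rw [Summable.tsum_finsetSum fun _ _ => ENNReal.summable]

/-- The expected propagation time is the least supersolution of its first-step equation. -/
theorem ept_le_of_supersolution (w : V → V → ℝ≥0) (f : Finset V → ℝ≥0∞)
    (hf : ∀ S, (if S = Finset.univ then 0 else 1) + ∑ C, stepProb w S C * f C ≤ f S)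
    (S : Finset V) : ept w S ≤ f S := by
  rw [ept_eq_tsum_tail, ENNReal.tsum_eq_iSup_nat]
  refine iSup_le fun T => ?_
  induction T generalizing S with
  | zero => simp
  | succ T ih =>
    refine le_trans ?_ (hf S)
    rw [Finset.sum_range_succ', add_comm, tail_zero]
    gcongr
    simp_rw [tail_succ]
    rw [Finset.sum_comm]
    simp_rw [← Finset.mul_sum]
    gcongr with C
    exact ih C

theorem ept_univ (w : V → V → ℝ≥0) : ept w Finset.univ = 0 := by
  refine le_antisymm ((ept_le_of_supersolution w
    (fun S => if S = Finset.univ then 0 else ⊤) (fun S => ?_) _).trans_eq (by simp)) zero_le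
  by_cases hS : S = Finset.univ
  · subst hS
    simp only [if_true, zero_add, nonpos_iff_eq_zero]
    refine Finset.sum_eq_zero fun C _ => ?_
    by_cases hC : C = Finset.univ
    · simp [hC]
    · rw [stepProb, if_neg fun h => hC (Finset.univ_subset_iff.1 h), zero_mul]
  · simp [hS]

theorem one_add_geometric {p : ℝ≥0∞} (hp : p ≠ 0) (hp1 : p ≤ 1) (e : ℝ≥0∞) :
    1 + (p * e + (1 - p) * (p⁻¹ + e)) = p⁻¹ + e := by
  have hpt : p ≠ ⊤ := ne_top_of_le_ne_top ENNReal.one_ne_top hp1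
  calc 1 + (p * e + (1 - p) * (p⁻¹ + e)) = (p + (1 - p)) * (p⁻¹ + e) := by
        rw [add_mul, mul_add p, ENNReal.mul_inv_cancel hp hpt, add_assoc]
    _ = p⁻¹ + e := by rw [add_tsub_cancel_of_le hp1, one_mul]

/-- If only `y` can turn blue, a geometric waiting time passes before it does. -/
theorem ept_of_single (w : V → V → ℝ≥0) {S : Finset V} {y : V} (hy : y ∉ S)
    (h0 : turnProb w S y ≠ 0) (hw : ∀ x ∉ S, x ≠ y → turnProb w S x = 0) :
    ept w S = (turnProb w S y : ℝ≥0∞)⁻¹ + ept w (insert y S) := by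
  set p : ℝ≥0∞ := (turnProb w S y : ℝ≥0∞) with hp
  have hp0 : p ≠ 0 := by simpa [hp] using h0
  have hp1 : p ≤ 1 := ENNReal.coe_le_one_iff.2 (turnProb_le_one w S y)
  have hS : S ≠ Finset.univ := fun h => hy (h ▸ Finset.mem_univ y)
  have hne : insert y S ≠ S := fun h => hy (h ▸ Finset.mem_insert_self y S)
  have hsum (f : Finset V → ℝ≥0∞) :
      ∑ C, stepProb w S C * f C = p * f (insert y S) + (1 - p) * f S := by
    simp_rw [stepProb_eq_addKernel]
    exact sum_addKernel_mul_of_single hy (fun x hx hxy => by simp [hw x hx hxy]) f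
  have hle : ept w S ≤ p⁻¹ + ept w (insert y S) := by
    by_contra! hlt
    refine hlt.not_ge ((ept_le_of_supersolution w
      (Function.update (ept w) S (p⁻¹ + ept w (insert y S))) (fun C => ?_) S).trans_eq (by simp))
    by_cases hC : C = S
    · subst hC
      rw [hsum]
      simp [hS, hne, one_add_geometric hp0 hp1]
    · rw [Function.update_of_ne hC]
      conv_rhs => rw [ept_eq]
      gcongr with D
      by_cases hD : D = S
      · subst hD
        simpa using hlt.le
      · simp [hD]
  refine le_antisymm hle ?_
  by_cases htop : ept w S = ⊤
  · simp [htop]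
  have heq := ept_eq w S
  rw [hsum, if_neg hS] at heq
  have hpt : p ≠ ⊤ := ne_top_of_le_ne_top ENNReal.one_ne_top hp1
  have hfin : (1 - p) * ept w S ≠ ⊤ :=
    ENNReal.mul_ne_top (ne_top_of_le_ne_top ENNReal.one_ne_top tsub_le_self) htop
  have hsplit : p * ept w S + (1 - p) * ept w S = ept w S := by
    rw [← add_mul, add_tsub_cancel_of_le hp1, one_mul]
  have hmul : p * ept w S = 1 + p * ept w (insert y S) := by
    refine (ENNReal.add_left_inj hfin).1 ?_
    rw [hsplit, add_assoc]
    exact heq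
  have : p * (p⁻¹ + ept w (insert y S)) = p * ept w S := by
    rw [mul_add, ENNReal.mul_inv_cancel hp0 hpt, hmul]
  exact ((ENNReal.mul_right_inj hp0 hpt).1 this).le

end FirstStep

section Join

variable {V₁ V₂ : Type*} [Fintype V₁] [DecidableEq V₁] [Fintype V₂] [DecidableEq V₂]
  (wG : V₁ → V₁ → ℝ≥0) (wH : V₂ → V₂ → ℝ≥0) (u : V₁) (v : V₂) (ω : ℝ≥0)

theorem turnProb_join_inl (A : Finset V₁) (B : Finset V₂) (a : V₁) :
    turnProb (joinWeight wG wH u v ω) (A.disjSum B) (Sum.inl a) = turnProb wG A a := by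
  simp [turnProb, joinWeight, Finset.sum_disjSum]

theorem turnProb_join_inr_of_ne (A : Finset V₁) (B : Finset V₂) {b : V₂} (hb : b ≠ v) :
    turnProb (joinWeight wG wH u v ω) (A.disjSum B) (Sum.inr b) = turnProb wH B b := by
  simp [turnProb, joinWeight, Finset.sum_disjSum, hb]

theorem turnProb_join_inr_self (A : Finset V₁) :
    turnProb (joinWeight wG wH u v ω) (A.disjSum ∅) (Sum.inr v) =
      if u ∈ A then ω / (∑ z, wH z v + ω) else 0 := by
  by_cases hu : u ∈ A <;>
    simp [turnProb, joinWeight, hu, add_comm]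

theorem stepProb_join (A A' : Finset V₁) (B B' : Finset V₂) :
    stepProb (joinWeight wG wH u v ω) (A.disjSum B) (A'.disjSum B') =
      stepProb wG A A' * addKernel (fun b =>
        (turnProb (joinWeight wG wH u v ω) (A.disjSum B) (Sum.inr b) : ℝ≥0∞)) B B' := by
  simp_rw [stepProb_eq_addKernel, addKernel, Fintype.prod_sum_type, turnProb_join_inl,
    Finset.inl_mem_disjSum, Finset.inr_mem_disjSum]

theorem sum_stepProb_join (A : Finset V₁) (B : Finset V₂) (g : Finset V₁ → ℝ≥0∞)
    (h : Finset V₂ → ℝ≥0∞) :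
    ∑ C, stepProb (joinWeight wG wH u v ω) (A.disjSum B) C * (g C.toLeft + h C.toRight) =
      ∑ A', stepProb wG A A' * g A' + ∑ B', addKernel (fun b =>
        (turnProb (joinWeight wG wH u v ω) (A.disjSum B) (Sum.inr b) : ℝ≥0∞)) B B' * h B' := by
  rw [← Finset.sumEquiv.toEquiv.symm.sum_comp, Fintype.sum_prod_type]
  simp only [Finset.sumEquiv, Equiv.coe_fn_symm_mk, Finset.toLeft_disjSum,
    Finset.toRight_disjSum, stepProb_join]
  set k := addKernel (fun b =>
    (turnProb (joinWeight wG wH u v ω) (A.disjSum B) (Sum.inr b) : ℝ≥0∞)) B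
  have hk : ∑ B', k B' = 1 :=
    sum_addKernel (fun b => by exact_mod_cast turnProb_le_one _ _ _) B
  simp_rw [mul_add, Finset.sum_add_distrib]
  congr 1
  · refine Finset.sum_congr rfl fun A' _ => ?_
    simp_rw [mul_right_comm _ _ (g A')]
    rw [← Finset.mul_sum, hk, mul_one]
  · simp_rw [mul_assoc, ← Finset.mul_sum]
    rw [← Finset.sum_mul, sum_stepProb, one_mul]

theorem ept_join_le (hω : 0 < ω) (x : V₁) :
    ept (joinWeight wG wH u v ω) {Sum.inl x} ≤
      ((ω / (∑ z, wH z v + ω) : ℝ≥0) : ℝ≥0∞)⁻¹ + ept wG {x} + ept wH {v} := by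
  set p : ℝ≥0 := ω / (∑ z, wH z v + ω) with hp
  have hp0 : (p : ℝ≥0∞) ≠ 0 := by
    rw [ENNReal.coe_ne_zero]
    positivity
  have hp1 : (p : ℝ≥0∞) ≤ 1 := by
    exact_mod_cast div_le_one_of_le₀ le_add_self zero_le
  let h : Finset V₂ → ℝ≥0∞ := fun B =>
    if B = ∅ then (p : ℝ≥0∞)⁻¹ + ept wH {v} else if v ∈ B then ept wH B else ⊤
  have hmem {B : Finset V₂} (hB : v ∈ B) : h B = ept wH B := by
    simp [h, hB, Finset.ne_empty_of_mem hB]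
  refine (ept_le_of_supersolution _ (fun S => ept wG S.toLeft + h S.toRight)
    (fun S => ?_) _).trans_eq ?_
  · obtain ⟨A, B, rfl⟩ : ∃ A B, S = Finset.disjSum A B :=
      ⟨_, _, Finset.toLeft_disjSum_toRight.symm⟩
    rw [sum_stepProb_join, Finset.toLeft_disjSum, Finset.toRight_disjSum]
    by_cases hB : B = ∅
    · subst hB
      rw [sum_addKernel_mul_of_single (Finset.notMem_empty v)
        (fun b _ hb => by rw [turnProb_join_inr_of_ne _ _ _ _ _ _ _ hb]; simp [turnProb]),
        turnProb_join_inr_self, insert_empty_eq, hmem (Finset.mem_singleton_self v)]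
      have hne : A.disjSum (∅ : Finset V₂) ≠ Finset.univ := fun hu => by
        have := Finset.mem_univ (Sum.inr v : V₁ ⊕ V₂)
        simp [← hu] at this
      have h0 : h ∅ = (p : ℝ≥0∞)⁻¹ + ept wH {v} := by simp [h]
      rw [if_neg hne, h0, ept_eq wG A]
      by_cases hu : u ∈ A
      · rw [if_pos hu, ← hp, add_left_comm, one_add_geometric hp0 hp1]
        gcongr
        exact le_add_self
      · have hA : A ≠ Finset.univ := fun hA => hu (hA ▸ Finset.mem_univ u)
        simp [hu, hA, add_assoc]
    by_cases hv : v ∈ B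
    · have hker (B' : Finset V₂) : addKernel (fun b => (turnProb (joinWeight wG wH u v ω)
          (A.disjSum B) (Sum.inr b) : ℝ≥0∞)) B B' * h B' = stepProb wH B B' * ept wH B' := by
        rw [addKernel_congr (r := fun b => (turnProb wH B b : ℝ≥0∞)) (fun b hb => by
          rw [turnProb_join_inr_of_ne _ _ _ _ _ _ _ (ne_of_mem_of_not_mem hv hb).symm]),
          ← stepProb_eq_addKernel]
        by_cases hsub : B ⊆ B'
        · rw [hmem (hsub hv)]
        · simp [stepProb, hsub]
      simp_rw [hker]
      rw [hmem hv, ept_eq wG A, ept_eq wH B, add_add_add_comm]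
      gcongr
      by_cases hA : A = Finset.univ
      · by_cases hB' : B = Finset.univ
        · simp [hA, hB']
        · rw [if_neg hB']
          exact le_add_left (by split_ifs <;> simp)
      · rw [if_neg hA]
        exact le_add_right (by split_ifs <;> simp)
    · simp [h, hB, hv]
  · have hl : ({Sum.inl x} : Finset (V₁ ⊕ V₂)) = Finset.disjSum {x} ∅ := by ext (a | b) <;> simp
    rw [hl, Finset.toLeft_disjSum, Finset.toRight_disjSum]
    simp only [h, if_true]
    rw [← add_assoc, add_comm (ept wG {x})]

end Join

/-- Weights on two vertices: an edge of weight `1` from `0` to `1`, and loops of weight `a` at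
`0` and `b` at `1`. -/
def loopedEdge (a b : ℝ≥0) : Fin 2 → Fin 2 → ℝ≥0 := !![a, 1; 0, b]

theorem turnProb_loopedEdge (a b : ℝ≥0) : turnProb (loopedEdge a b) {0} 1 = (1 + b)⁻¹ := by
  simp [turnProb, loopedEdge]

theorem ept_loopedEdge (a b : ℝ≥0) : ept (loopedEdge a b) {0} = 1 + b := by
  have hU : insert 1 {0} = (Finset.univ : Finset (Fin 2)) := by decide
  rw [ept_of_single _ (y := 1) (by decide) (by rw [turnProb_loopedEdge]; positivity)
      (fun x hx hx1 => by fin_cases x <;> simp at hx hx1),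
    hU, ept_univ, turnProb_loopedEdge, ENNReal.coe_inv (by positivity), inv_inv, add_zero]
  push_cast
  rfl

theorem ept_join_loopedEdge (a b c ω : ℝ≥0) (hω : 0 < ω) :
    ept (joinWeight (loopedEdge 0 a) (loopedEdge c b) 1 0 ω) {Sum.inl 0} =
      ((ω / (c + ω) : ℝ≥0) : ℝ≥0∞)⁻¹ + (1 + a) + (1 + b) := by
  have h1 : ({Sum.inl 0} : Finset (Fin 2 ⊕ Fin 2)) = Finset.disjSum {0} ∅ := by decide
  have h2 : insert (Sum.inl 1) (Finset.disjSum {0} ∅) =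
      Finset.disjSum (Finset.univ : Finset (Fin 2)) (∅ : Finset (Fin 2)) := by decide
  have h3 : insert (Sum.inr 0) (Finset.disjSum Finset.univ ∅) =
      Finset.disjSum (Finset.univ : Finset (Fin 2)) ({0} : Finset (Fin 2)) := by decide
  have h4 : insert (Sum.inr 1) (Finset.disjSum Finset.univ {0}) =
      (Finset.univ : Finset (Fin 2 ⊕ Fin 2)) := by decide
  have hc : ∑ z, loopedEdge c b z 0 = c := by simp [loopedEdge]
  have ht1 : turnProb (joinWeight (loopedEdge 0 a) (loopedEdge c b) 1 0 ω)
      (Finset.disjSum {0} ∅) (Sum.inl 1) = (1 + a)⁻¹ := by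
    rw [turnProb_join_inl, turnProb_loopedEdge]
  have ht2 : turnProb (joinWeight (loopedEdge 0 a) (loopedEdge c b) 1 0 ω)
      (Finset.disjSum Finset.univ ∅) (Sum.inr 0) = ω / (c + ω) := by
    rw [turnProb_join_inr_self, if_pos (Finset.mem_univ _), hc]
  have ht3 : turnProb (joinWeight (loopedEdge 0 a) (loopedEdge c b) 1 0 ω)
      (Finset.disjSum Finset.univ {0}) (Sum.inr 1) = (1 + b)⁻¹ := by
    rw [turnProb_join_inr_of_ne _ _ _ _ _ _ _ (by decide), turnProb_loopedEdge]
  rw [h1, ept_of_single _ (y := Sum.inl 1) (by decide) (by rw [ht1]; positivity), h2, ht1,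
    ept_of_single _ (y := Sum.inr 0) (by decide) (by rw [ht2]; positivity), h3, ht2,
    ept_of_single _ (y := Sum.inr 1) (by decide) (by rw [ht3]; positivity), h4, ht3, ept_univ,
    ENNReal.coe_inv (by positivity), ENNReal.coe_inv (by positivity), inv_inv, inv_inv, add_zero]
  · push_cast
    ring
  · rintro (x | x) hx hx1 <;> fin_cases x <;> simp at hx hx1
  · rintro (x | x) hx hx1 <;> fin_cases x <;> simp at hx hx1
    simp [turnProb, joinWeight]
  · rintro (x | x) hx hx1 <;> fin_cases x <;> simp at hx hx1 <;>
      simp [turnProb, joinWeight]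

theorem coe_div_add_inv (d : ℝ≥0) {ω : ℝ≥0} (hω : 0 < ω) :
    ((ω / (d + ω) : ℝ≥0) : ℝ≥0∞)⁻¹ = (d + ω) / ω := by
  rw [← ENNReal.coe_inv (by positivity), inv_div, ENNReal.coe_div hω.ne', ENNReal.coe_add]

end RZF

/-- If `K` is obtained from disjoint weighted digraphs `G`
and `H` by adding one edge of weight `ω > 0` from `u ∈ V(G)` to `v ∈ V(H)`,
where `v` has total incoming weight `d` in `H`, then for every `x ∈ V(G)`,
`ept_rzf(K, x) ≤ (d + ω)/ω + ept_rzf(G, x) + ept_rzf(H, v)`; moreover the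
bound is sharp: for all `m, n > 0` and all `d, ω > 0` there are such
`G, H, u, v, x` with `ept_rzf(G, x) = m`, `ept_rzf(H, v) = n`, and
`ept_rzf(K, x) = (d + ω)/ω + m + n`. -/
theorem rzf_join_ept :
    (∀ (V₁ V₂ : Type) [Fintype V₁] [DecidableEq V₁] [Fintype V₂] [DecidableEq V₂]
      (wG : V₁ → V₁ → ℝ≥0) (wH : V₂ → V₂ → ℝ≥0) (u : V₁) (v : V₂) (ω : ℝ≥0),
      0 < ω → ∀ x : V₁,
        RZF.ept (joinWeight wG wH u v ω) {Sum.inl x} ≤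
          (((∑ z : V₂, wH z v) : ℝ≥0∞) + (ω : ℝ≥0∞)) / (ω : ℝ≥0∞) +
            RZF.ept wG {x} + RZF.ept wH {v}) ∧
    (∀ m n : ℕ, 0 < m → 0 < n → ∀ d ω : ℝ≥0, 0 < d → 0 < ω →
      ∃ (n₁ n₂ : ℕ) (wG : Fin n₁ → Fin n₁ → ℝ≥0) (wH : Fin n₂ → Fin n₂ → ℝ≥0)
        (u x : Fin n₁) (v : Fin n₂),
        RZF.ept wG {x} = (m : ℝ≥0∞) ∧ RZF.ept wH {v} = (n : ℝ≥0∞) ∧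
        (∑ z : Fin n₂, wH z v) = d ∧
        RZF.ept (joinWeight wG wH u v ω) {Sum.inl x} =
          ((d : ℝ≥0∞) + (ω : ℝ≥0∞)) / (ω : ℝ≥0∞) + m + n) := by
  refine ⟨fun V₁ V₂ _ _ _ _ wG wH u v ω hω x => ?_, fun m n hm hn d ω _ hω => ?_⟩
  · have h := RZF.ept_join_le wG wH u v ω hω x
    rwa [RZF.coe_div_add_inv _ hω, ENNReal.ofNNReal_finsetSum] at h
  · obtain ⟨m, rfl⟩ := Nat.exists_eq_add_of_le hm
    obtain ⟨n, rfl⟩ := Nat.exists_eq_add_of_le hn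
    refine ⟨2, 2, RZF.loopedEdge 0 m, RZF.loopedEdge d n, 1, 0, 0, ?_, ?_, ?_, ?_⟩
    · simp [RZF.ept_loopedEdge]
    · simp [RZF.ept_loopedEdge]
    · simp [RZF.loopedEdge]
    · rw [RZF.ept_join_loopedEdge _ _ _ _ hω, RZF.coe_div_add_inv _ hω]
      simp
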